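/- arXiv:2204.14153 — 7 statements merged into one kernel-verified Lean document; each statement's English description precedes it below -/
import Mathlib

section
/- Let 𝒳 be a normal G-automaton with initial state x. Then for every w ∈ R(x), in the minimization m(𝒳) one has ⟦𝒳⟧ →^w w⁻¹⟦𝒳⟧. In particular, m(𝒳) is reachable: every state of m(𝒳) is reachable from its initial state ⟦𝒳⟧. -/
open scoped Classical

/-- Guarded strings `GS = (At·Σ)*·At`, represented as a pair of a word in
`(At·Σ)*` (the guarded string without terminating atom) and a terminating atom. -/
abbrev GS (At Act : Type*) := List (At × Act) × At

variable {At Act X Y : Type*}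

/-- Acceptance of a guarded string by a state of a `G`-coalgebra. -/
def GAccepts (δ : X → At → Bool ⊕ (Act × X)) : X → List (At × Act) → At → Prop
  | x, [], β => δ x β = Sum.inl true
  | x, (α, p) :: w, β => ∃ y, δ x α = Sum.inr (p, y) ∧ GAccepts δ y w β

/-- The language `⟦x⟧ ⊆ GS` of a state of a `G`-coalgebra. -/
def glang (δ : X → At → Bool ⊕ (Act × X)) (x : X) : Set (GS At Act) :=
  {g | GAccepts δ x g.1 g.2}

/-- The transition relation `x →^w y` of a `G`-coalgebra. -/
inductive GReaches (δ : X → At → Bool ⊕ (Act × X)) : X → List (At × Act) → X → Prop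
  | refl (x : X) : GReaches δ x [] x
  | single {x : X} {α : At} {p : Act} {y : X} :
      δ x α = Sum.inr (p, y) → GReaches δ x [(α, p)] y
  | snoc {x y z : X} {v : List (At × Act)} {α : At} {p : Act} :
      GReaches δ x v y → δ y α = Sum.inr (p, z) → GReaches δ x (v ++ [(α, p)]) z

/-- The set `r(x)` of states reachable from `x`. -/
def grState (δ : X → At → Bool ⊕ (Act × X)) (x : X) : Set X :=
  {y | ∃ w, GReaches δ x w y}

/-- The set `R(x)` of words witnessing reachability from `x`. -/
def gRWords (δ : X → At → Bool ⊕ (Act × X)) (x : X) : Set (List (At × Act)) :=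
  {w | ∃ y, GReaches δ x w y}

/-- A `G`-coalgebra is normal if it only transitions to live states. -/
def GNormal (δ : X → At → Bool ⊕ (Act × X)) : Prop :=
  ∀ x α p y, δ x α = Sum.inr (p, y) → (glang δ y).Nonempty

/-- The derivative `w⁻¹L` of a guarded-string language. -/
def gderiv (w : List (At × Act)) (L : Set (GS At Act)) : Set (GS At Act) :=
  {u | (w ++ u.1, u.2) ∈ L}

/-- The transition map of the minimization `m(𝒳)` (defined on all of `Set GS`). -/
noncomputable def minDelta : Set (GS At Act) → At → Bool ⊕ (Act × Set (GS At Act)) :=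
  fun L α =>
    if h : ∃ p : Act, (gderiv [(α, p)] L).Nonempty then
      Sum.inr (h.choose, gderiv [(α, h.choose)] L)
    else if (([], α) : GS At Act) ∈ L then Sum.inl true
    else Sum.inl false

/-- The state space `{w⁻¹⟦𝒳⟧ | w ∈ R(x)}` of the minimization `m(𝒳)`. -/
def MinStates (δ : X → At → Bool ⊕ (Act × X)) (x : X) : Set (Set (GS At Act)) :=
  {L | ∃ w ∈ gRWords δ x, L = gderiv w (glang δ x)}

/-- Restriction of a `G`-coalgebra to an invariant subset of states. -/
def grestrict (δ : X → At → Bool ⊕ (Act × X)) (A : Set X)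
    (hA : ∀ y ∈ A, ∀ (α : At) (p : Act) (z : X), δ y α = Sum.inr (p, z) → z ∈ A) :
    A → At → Bool ⊕ (Act × A) := fun y α =>
  match h : δ y.val α with
  | Sum.inl b => Sum.inl b
  | Sum.inr (p, z) => Sum.inr (p, ⟨z, hA y.val y.2 α p z h⟩)

/-- Compatibility of two guarded strings: they agree on their first `n` actions
(or lack thereof) whenever they agree on their first `n` atoms. -/
def GCompat : List (At × Act) → At → List (At × Act) → At → Prop
  | [], _, [], _ => True
  | [], β, (α, _) :: _, _ => β ≠ α
  | (α, _) :: _, _, [], β => β ≠ α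
  | (α, p) :: u, β, (α', p') :: u', β' => α = α' → p = p' ∧ GCompat u β u' β'

/-- A guarded-string language is deterministic if any two of its strings that agree
on their first `n` atoms also agree on their first `n` actions (or lack thereof). -/
def GDetLang (L : Set (GS At Act)) : Prop :=
  ∀ u ∈ L, ∀ v ∈ L, GCompat u.1 u.2 v.1 v.2

/-- Bisimulations between `G`-coalgebras. -/
def IsGBisim (δX : X → At → Bool ⊕ (Act × X)) (δY : Y → At → Bool ⊕ (Act × Y))
    (R : X → Y → Prop) : Prop :=
  ∀ x y, R x y → ∀ α : At,
    (∀ b : Bool, δX x α = Sum.inl b → δY y α = Sum.inl b) ∧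
    (∀ p x', δX x α = Sum.inr (p, x') → ∃ y', δY y α = Sum.inr (p, y') ∧ R x' y')

/-- Bisimilarity of states of `G`-coalgebras. -/
def GBisimilar (δX : X → At → Bool ⊕ (Act × X)) (δY : Y → At → Bool ⊕ (Act × Y))
    (x : X) (y : Y) : Prop :=
  ∃ R, IsGBisim δX δY R ∧ R x y

/-- Simulations between `G`-coalgebras. -/
def IsGSim (δX : X → At → Bool ⊕ (Act × X)) (δY : Y → At → Bool ⊕ (Act × Y))
    (R : X → Y → Prop) : Prop :=
  ∀ x y, R x y → ∀ α : At,
    (δX x α = Sum.inl true → δY y α = Sum.inl true) ∧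
    (∀ p x', δX x α = Sum.inr (p, x') → ∃ y', δY y α = Sum.inr (p, y') ∧ R x' y')

/-- Similarity of states of `G`-coalgebras. -/
def GSimilar (δX : X → At → Bool ⊕ (Act × X)) (δY : Y → At → Bool ⊕ (Act × Y))
    (x : X) (y : Y) : Prop :=
  ∃ R, IsGSim δX δY R ∧ R x y

/-- Observation tables for the `GL*` algorithm. -/
structure ObsTable (At Act : Type*) where
  S : Set (List (At × Act))
  E : Set (GS At Act)
  row : List (At × Act) → Set (GS At Act)
  eps_mem : [] ∈ S
  atoms_mem : ∀ α : At, (([], α) : GS At Act) ∈ E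
  prefix_closed : ∀ (s : List (At × Act)) (α : At) (p : Act), s ++ [(α, p)] ∈ S → s ∈ S
  suffix_closed : ∀ (α : At) (p : Act) (e : GS At Act), (((α, p) :: e.1, e.2) : GS At Act) ∈ E → e ∈ E
  row_sub : ∀ t, row t ⊆ E
  rows_distinct : ∀ s ∈ S, ∀ t ∈ S, row s = row t → s = t
  row_nonempty : ∀ s ∈ S, s ≠ [] → (row s).Nonempty
  row_compat : ∀ s ∈ S, ∀ (α : At) (p : Act) (e : GS At Act),
      (((α, p) :: e.1, e.2) : GS At Act) ∈ E →
      (e ∈ row (s ++ [(α, p)]) ↔ (((α, p) :: e.1, e.2) : GS At Act) ∈ row s)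

/-- A table is deterministic if all of its upper rows are deterministic languages. -/
def ObsTable.Det (T : ObsTable At Act) : Prop := ∀ s ∈ T.S, GDetLang (T.row s)

/-- A table is closed if every nonzero lower row equals some upper row. -/
def ObsTable.Closed (T : ObsTable At Act) : Prop :=
  ∀ s ∈ T.S, ∀ (α : At) (p : Act), (T.row (s ++ [(α, p)])).Nonempty →
    ∃ t ∈ T.S, T.row t = T.row (s ++ [(α, p)])

/-- The transition map of the hypothesis automaton `m(T)` (defined on all of `Set GS`). -/
noncomputable def hypDelta (T : ObsTable At Act) :
    Set (GS At Act) → At → Bool ⊕ (Act × Set (GS At Act)) := fun L α =>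
  if h : ∃ s, s ∈ T.S ∧ T.row s = L then
    if hp : ∃ p : Act, (T.row (h.choose ++ [(α, p)])).Nonempty then
      Sum.inr (hp.choose, T.row (h.choose ++ [(α, hp.choose)]))
    else if (([], α) : GS At Act) ∈ L then Sum.inl true
    else Sum.inl false
  else Sum.inl false

/-- The state space `{row(s) | s ∈ S}` of the hypothesis automaton `m(T)`. -/
def HypStates (T : ObsTable At Act) : Set (Set (GS At Act)) := T.row '' T.S

/-- A `G`-automaton `(Y, δY, y)` is consistent with an observation table `T`. -/
def ConsistentWith (T : ObsTable At Act) (δY : Y → At → Bool ⊕ (Act × Y)) (y : Y) : Prop :=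
  T.S ⊆ gRWords δY y ∧
  ∀ s ∈ T.S, ∀ ys, GReaches δY y s ys → ∀ e ∈ T.E, (e ∈ glang δY ys ↔ e ∈ T.row s)

/-- Guarded-string suffixes of a guarded string (auxiliary version). -/
def gsufAux : List (At × Act) → At → Set (GS At Act)
  | [], β => {(([] : List (At × Act)), β)}
  | ap :: w, β => insert ((ap :: w, β) : GS At Act) (gsufAux w β)

/-- The set `suf(z)` of guarded-string suffixes of a guarded string `z`. -/
def gsuf (z : GS At Act) : Set (GS At Act) := gsufAux z.1 z.2

/-- Acceptance for Moore automata with input `At·Σ` and output `2^At`. -/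
def MAccepts (tr : Y → (At × Act) → Y) (out : Y → At → Bool) : Y → List (At × Act) → At → Prop
  | y, [], β => out y β = true
  | y, ap :: w, β => MAccepts tr out (tr y ap) w β

/-- The language of a state of a Moore automaton with input `At·Σ` and output `2^At`. -/
def mlang (tr : Y → (At × Act) → Y) (out : Y → At → Bool) (y : Y) : Set (GS At Act) :=
  {g | MAccepts tr out y g.1 g.2}

/-- Transition map of the Moore automaton `f(𝒳)` obtained from a `G`-automaton
by adding a sink state `⋆` (`= none`). -/
noncomputable def fTrans (δ : X → At → Bool ⊕ (Act × X)) : Option X → (At × Act) → Option X :=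
  fun s ap =>
    match s with
    | none => none
    | some y =>
      match δ y ap.1 with
      | Sum.inl _ => none
      | Sum.inr (q, z) => if q = ap.2 then some z else none

/-- Output map of the Moore automaton `f(𝒳)`. -/
noncomputable def fOut (δ : X → At → Bool ⊕ (Act × X)) : Option X → At → Bool :=
  fun s α =>
    match s with
    | none => false
    | some y => if δ y α = Sum.inl true then true else false

theorem gderiv_nil (L : Set (GS At Act)) : gderiv [] L = L := rfl

theorem gderiv_append (v w : List (At × Act)) (L : Set (GS At Act)) :
    gderiv (v ++ w) L = gderiv w (gderiv v L) := by
  ext u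
  simp [gderiv]

theorem mem_gderiv_singleton_glang {δ : X → At → Bool ⊕ (Act × X)} {y : X} {α : At} {p : Act}
    {u : GS At Act} :
    u ∈ gderiv [(α, p)] (glang δ y) ↔ ∃ z, δ y α = Sum.inr (p, z) ∧ u ∈ glang δ z :=
  Iff.rfl

theorem gderiv_singleton_glang {δ : X → At → Bool ⊕ (Act × X)} {y z : X} {α : At} {p : Act}
    (h : δ y α = Sum.inr (p, z)) : gderiv [(α, p)] (glang δ y) = glang δ z := by
  ext u
  simp [mem_gderiv_singleton_glang, h]

/-- Over a normal coalgebra, the minimization mirrors each transition on languages. -/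
theorem minDelta_glang {δ : X → At → Bool ⊕ (Act × X)} (hN : GNormal δ) {y z : X} {α : At}
    {p : Act} (h : δ y α = Sum.inr (p, z)) :
    minDelta (glang δ y) α = Sum.inr (p, glang δ z) := by
  have hex : ∃ q : Act, (gderiv [(α, q)] (glang δ y)).Nonempty :=
    ⟨p, gderiv_singleton_glang h ▸ hN y α p z h⟩
  have hchoose : hex.choose = p := by
    obtain ⟨u, hu⟩ := hex.choose_spec
    obtain ⟨z', hz', -⟩ := mem_gderiv_singleton_glang.mp hu
    rw [h] at hz'
    exact (congrArg Prod.fst (Sum.inr.inj hz')).symm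
  rw [minDelta, dif_pos hex, hchoose, gderiv_singleton_glang h]

theorem GReaches.gderiv_glang {δ : X → At → Bool ⊕ (Act × X)} {x y : X}
    {w : List (At × Act)} (h : GReaches δ x w y) : gderiv w (glang δ x) = glang δ y := by
  induction h with
  | refl => exact gderiv_nil _
  | single h => exact gderiv_singleton_glang h
  | snoc _ h ih => rw [gderiv_append, ih, gderiv_singleton_glang h]

theorem GReaches.minDelta_glang {δ : X → At → Bool ⊕ (Act × X)} (hN : GNormal δ) {x y : X}
    {w : List (At × Act)} (h : GReaches δ x w y) :
    GReaches minDelta (glang δ x) w (glang δ y) := by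
  induction h with
  | refl => exact .refl _
  | single h => exact .single (_root_.minDelta_glang hN h)
  | snoc _ h ih => exact .snoc ih (_root_.minDelta_glang hN h)

/-- for a normal `G`-automaton, `⟦𝒳⟧ →^w w⁻¹⟦𝒳⟧` holds in the minimization
`m(𝒳)` for every `w ∈ R(x)`; in particular `m(𝒳)` is reachable. -/
theorem minimization_reachable {At Act : Type*} [Fintype At] [Nonempty At] [Fintype Act] [Nonempty Act] {X : Type*}
    (δ : X → At → Bool ⊕ (Act × X)) (x : X) (hN : GNormal δ) :
    (∀ w ∈ gRWords δ x, GReaches minDelta (glang δ x) w (gderiv w (glang δ x))) ∧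
    (∀ L ∈ MinStates δ x, ∃ w, GReaches minDelta (glang δ x) w L) := by
  have hreach : ∀ w ∈ gRWords δ x,
      GReaches minDelta (glang δ x) w (gderiv w (glang δ x)) := by
    rintro w ⟨y, hy⟩
    rw [hy.gderiv_glang]
    exact hy.minDelta_glang hN
  refine ⟨hreach, ?_⟩
  rintro _ ⟨w, hw, rfl⟩
  exact ⟨w, hreach w hw⟩
end

section
/- For any G-automaton 𝒳, the minimization m(𝒳) is normal and observable. -/
open scoped Classical

variable {At Act X Y : Type*}

theorem exists_glang_of_mem_minStates {δ : X → At → Bool ⊕ (Act × X)} {x : X}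
    {L : Set (GS At Act)} (h : L ∈ MinStates δ x) : ∃ y, L = glang δ y := by
  obtain ⟨w, ⟨y, hy⟩, rfl⟩ := h
  exact ⟨y, hy.gderiv_glang⟩

theorem minDelta_glang_eq_inr_iff (δ : X → At → Bool ⊕ (Act × X)) (y : X) (α : At) (p : Act)
    (L : Set (GS At Act)) :
    minDelta (glang δ y) α = Sum.inr (p, L) ↔
      ∃ z, δ y α = Sum.inr (p, z) ∧ (glang δ z).Nonempty ∧ L = glang δ z := by
  unfold minDelta
  split_ifs with h h'
  · obtain ⟨u, z, hz, hu⟩ := h.choose_spec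
    rw [gderiv_singleton_glang hz]
    constructor
    · intro e
      obtain ⟨rfl, rfl⟩ := Prod.mk.inj (Sum.inr.inj e)
      exact ⟨z, hz, ⟨u, hu⟩, rfl⟩
    · rintro ⟨z', hz', -, rfl⟩
      obtain ⟨hp, rfl⟩ := Prod.mk.inj (Sum.inr.inj (hz.symm.trans hz'))
      rw [hp]
  all_goals
    simp only [false_iff]
    rintro ⟨z, hz, hne, -⟩
    exact h ⟨p, by rwa [gderiv_singleton_glang hz]⟩

theorem minDelta_glang_eq_inl_true_iff (δ : X → At → Bool ⊕ (Act × X)) (y : X) (α : At) :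
    minDelta (glang δ y) α = Sum.inl true ↔ δ y α = Sum.inl true := by
  unfold minDelta
  split_ifs with h h'
  · obtain ⟨p, u, z, hz, -⟩ := h
    simp [show δ y α = Sum.inr (p, z) from hz]
  · simpa using show δ y α = Sum.inl true from h'
  · simpa using show ¬ δ y α = Sum.inl true from h'

theorem glang_minDelta_glang (δ : X → At → Bool ⊕ (Act × X)) (y : X) :
    glang minDelta (glang δ y) = glang δ y := by
  ext ⟨w, β⟩
  change GAccepts minDelta (glang δ y) w β ↔ GAccepts δ y w β
  induction w generalizing y with
  | nil => exact minDelta_glang_eq_inl_true_iff δ y β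
  | cons a w ih =>
    obtain ⟨α, p⟩ := a
    simp only [GAccepts, minDelta_glang_eq_inr_iff]
    constructor
    · rintro ⟨_, ⟨z, hz, -, rfl⟩, hw⟩
      exact ⟨z, hz, (ih z).1 hw⟩
    · rintro ⟨z, hz, hw⟩
      exact ⟨_, ⟨z, hz, ⟨(w, β), hw⟩, rfl⟩, (ih z).2 hw⟩

/-- the minimization `m(𝒳)` is normal and observable. -/
theorem minimization_normal_observable {At Act : Type*} [Fintype At] [Nonempty At] [Fintype Act] [Nonempty Act] {X : Type*}
    (δ : X → At → Bool ⊕ (Act × X)) (x : X) :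
    (∀ L ∈ MinStates δ x, ∀ (α : At) (p : Act) (L' : Set (GS At Act)),
        minDelta L α = Sum.inr (p, L') → (glang minDelta L').Nonempty) ∧
    (∀ L ∈ MinStates δ x, ∀ L' ∈ MinStates δ x,
        glang minDelta L = glang minDelta L' → L = L') := by
  constructor
  · intro L hL α p L' h
    obtain ⟨y, rfl⟩ := exists_glang_of_mem_minStates hL
    obtain ⟨z, -, hne, rfl⟩ := (minDelta_glang_eq_inr_iff δ y α p L').1 h
    rwa [glang_minDelta_glang]
  · intro L hL L' hL' h
    obtain ⟨y, rfl⟩ := exists_glang_of_mem_minStates hL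
    obtain ⟨y', rfl⟩ := exists_glang_of_mem_minStates hL'
    rwa [glang_minDelta_glang, glang_minDelta_glang] at h
end

section
/- Let 𝒳 be a normal G-automaton with initial state x, and let π : r(𝒳) → m(𝒳) be the homomorphism defined by π(z) = w_z⁻¹⟦𝒳⟧ for any w_z with x →^{w_z} z. Then for all y, z ∈ r(x): y and z are bisimilar (y ≃ z) if and only if π(y) = π(z). -/
open scoped Classical

variable {At Act X Y : Type*}

/-- Acceptance after a word leading from `x` to `y` is acceptance from `y`. -/
theorem GReaches.accepts_append_iff {δ : X → At → Bool ⊕ (Act × X)} {x y : X}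
    {w : List (At × Act)} (h : GReaches δ x w y) (u : List (At × Act)) (β : At) :
    GAccepts δ x (w ++ u) β ↔ GAccepts δ y u β := by
  induction h generalizing u with
  | refl => rfl
  | single h => simp [GAccepts, h]
  | snoc _ h ih => simp [ih, GAccepts, h]

theorem IsGBisim.accepts_iff {δX : X → At → Bool ⊕ (Act × X)} {δY : Y → At → Bool ⊕ (Act × Y)}
    {R : X → Y → Prop} (hR : IsGBisim δX δY R) {x : X} {y : Y} (h : R x y)
    (w : List (At × Act)) (β : At) : GAccepts δX x w β ↔ GAccepts δY y w β := by
  induction w generalizing x y with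
  | nil =>
    obtain ⟨hl, hr⟩ := hR x y h β
    rcases hx : δX x β with b | ⟨p, x'⟩
    · simp [GAccepts, hx, hl b hx]
    · obtain ⟨y', hy, -⟩ := hr p x' hx
      simp [GAccepts, hx, hy]
  | cons a w ih =>
    obtain ⟨α, q⟩ := a
    obtain ⟨hl, hr⟩ := hR x y h α
    rcases hx : δX x α with b | ⟨p, x'⟩
    · simp [GAccepts, hx, hl b hx]
    · obtain ⟨y', hy, hxy⟩ := hr p x' hx
      simp [GAccepts, hx, hy, ih hxy]

/-- Bisimilar states have the same language. -/
theorem GBisimilar.glang_eq {δX : X → At → Bool ⊕ (Act × X)} {δY : Y → At → Bool ⊕ (Act × Y)}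
    {x : X} {y : Y} : GBisimilar δX δY x y → glang δX x = glang δY y :=
  fun ⟨_, hR, h⟩ => Set.ext fun u => hR.accepts_iff h u.1 u.2

/-- Between normal coalgebras, language equality is a bisimulation. -/
theorem isGBisim_glang_eq {δX : X → At → Bool ⊕ (Act × X)} {δY : Y → At → Bool ⊕ (Act × Y)}
    (hX : GNormal δX) (hY : GNormal δY) :
    IsGBisim δX δY fun x y => glang δX x = glang δY y := by
  intro x y h α
  have key (w : List (At × Act)) (β : At) : GAccepts δX x w β ↔ GAccepts δY y w β :=
    Set.ext_iff.mp h (w, β)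
  constructor
  · intro b hx
    rcases hy : δY y α with c | ⟨p, y'⟩
    · have := key [] α
      cases b <;> cases c <;> simp_all [GAccepts]
    · obtain ⟨⟨u, β⟩, hu⟩ := hY y α p y' hy
      obtain ⟨x', hx', -⟩ := (key ((α, p) :: u) β).mpr ⟨y', hy, hu⟩
      simp [hx] at hx'
  · intro p x' hx
    obtain ⟨⟨u, β⟩, hu⟩ := hX x α p x' hx
    obtain ⟨y', hy, -⟩ := (key ((α, p) :: u) β).mp ⟨x', hx, hu⟩
    refine ⟨y', hy, Set.ext fun v => ?_⟩
    simpa [glang, GAccepts, hx, hy] using key ((α, p) :: v.1) v.2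

/-- In normal coalgebras, bisimilarity coincides with language equality. -/
theorem gbisimilar_iff_glang_eq {δX : X → At → Bool ⊕ (Act × X)}
    {δY : Y → At → Bool ⊕ (Act × Y)} (hX : GNormal δX) (hY : GNormal δY) {x : X} {y : Y} :
    GBisimilar δX δY x y ↔ glang δX x = glang δY y :=
  ⟨GBisimilar.glang_eq, fun h => ⟨_, isGBisim_glang_eq hX hY, h⟩⟩

/-- for reachable states `y, z` of a normal `G`-automaton, `y` and `z` are
bisimilar iff `π(y) = π(z)`, i.e. iff `w_y⁻¹⟦𝒳⟧ = w_z⁻¹⟦𝒳⟧` for witnessing words. -/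
theorem bisimilar_iff_pi_eq {At Act : Type*} [Fintype At] [Nonempty At] [Fintype Act] [Nonempty Act] {X : Type*}
    (δ : X → At → Bool ⊕ (Act × X)) (x : X) (hN : GNormal δ)
    (y z : X) (hy : y ∈ grState δ x) (hz : z ∈ grState δ x)
    (wy wz : List (At × Act)) (hwy : GReaches δ x wy y) (hwz : GReaches δ x wz z) :
    GBisimilar δ δ y z ↔ gderiv wy (glang δ x) = gderiv wz (glang δ x) := by
  rw [hwy.gderiv_glang, hwz.gderiv_glang]
  exact gbisimilar_iff_glang_eq hN hN
end

section
/- Let 𝒳 and 𝒴 be finite normal G-automata with ⟦𝒳⟧ = ⟦𝒴⟧. Then the number of states of m(𝒳) is at most the number of states of 𝒴, and equality holds if and only if m(𝒳) and 𝒴 are isomorphic as G-automata. -/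
open scoped Classical

variable {At Act X Y : Type*}

section Reachability

variable {δ : X → At → Bool ⊕ (Act × X)} {x y z : X} {w u : List (At × Act)} {α β : At} {p : Act}

theorem GReaches.nil_iff : GReaches δ x [] y ↔ y = x := by
  constructor
  · intro h
    generalize hw : ([] : List (At × Act)) = w at h
    cases h with
    | refl => rfl
    | single => simp at hw
    | snoc => simp at hw
  · rintro rfl
    exact .refl _

theorem GReaches.append_singleton_iff :
    GReaches δ x (w ++ [(α, p)]) y ↔ ∃ z, GReaches δ x w z ∧ δ z α = Sum.inr (p, y) := by
  constructor
  · intro h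
    generalize hw : w ++ [(α, p)] = v at h
    cases h with
    | refl => simp at hw
    | single h =>
      obtain ⟨rfl, hw⟩ := List.append_inj' (hw.trans (List.nil_append _).symm) rfl
      obtain ⟨rfl, rfl⟩ : α = _ ∧ p = _ := by simpa using hw
      exact ⟨x, .refl x, h⟩
    | snoc h₁ h₂ =>
      obtain ⟨rfl, hw⟩ := List.append_inj' hw rfl
      obtain ⟨rfl, rfl⟩ : α = _ ∧ p = _ := by simpa using hw
      exact ⟨_, h₁, h₂⟩
  · rintro ⟨z, h₁, h₂⟩
    exact .snoc h₁ h₂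

theorem GReaches.unique (hy : GReaches δ x w y) (hz : GReaches δ x w z) : y = z := by
  induction w using List.reverseRecOn generalizing y z with
  | nil => rw [GReaches.nil_iff.1 hy, GReaches.nil_iff.1 hz]
  | append_singleton w a ih =>
    obtain ⟨y', hy₁, hy₂⟩ := GReaches.append_singleton_iff.1 hy
    obtain ⟨z', hz₁, hz₂⟩ := GReaches.append_singleton_iff.1 hz
    obtain rfl := ih hy₁ hz₁
    simpa using hy₂.symm.trans hz₂

theorem GAccepts.append_iff :
    GAccepts δ x (w ++ u) β ↔ ∃ z, GReaches δ x w z ∧ GAccepts δ z u β := by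
  induction w using List.reverseRecOn generalizing u with
  | nil => simp [GReaches.nil_iff]
  | append_singleton w a ih =>
    obtain ⟨α, p⟩ := a
    rw [List.append_assoc, ih]
    simp only [List.cons_append, List.nil_append, GAccepts, GReaches.append_singleton_iff]
    grind

theorem GReaches.glang_eq (h : GReaches δ x w y) : glang δ y = gderiv w (glang δ x) := by
  ext ⟨u, β⟩
  change GAccepts δ y u β ↔ GAccepts δ x (w ++ u) β
  rw [GAccepts.append_iff]
  refine ⟨fun hu => ⟨y, h, hu⟩, ?_⟩
  rintro ⟨z, hz, hu⟩
  rwa [h.unique hz]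

theorem exists_reaches_of_gderiv_nonempty (h : (gderiv w (glang δ x)).Nonempty) :
    ∃ y, GReaches δ x w y := by
  obtain ⟨⟨u, β⟩, hu⟩ := h
  obtain ⟨z, hz, -⟩ := GAccepts.append_iff.1 hu
  exact ⟨z, hz⟩

theorem GNormal.glang_nonempty (hN : GNormal δ) (h : GReaches δ x w y) (hw : w ≠ []) :
    (glang δ y).Nonempty := by
  cases h with
  | refl => exact absurd rfl hw
  | single h => exact hN _ _ _ _ h
  | snoc _ h => exact hN _ _ _ _ h

theorem GNormal.mem_gRWords_iff (hN : GNormal δ) :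
    w ∈ gRWords δ x ↔ w = [] ∨ (gderiv w (glang δ x)).Nonempty := by
  constructor
  · rintro ⟨y, h⟩
    by_cases hw : w = []
    · exact .inl hw
    · exact .inr (h.glang_eq ▸ hN.glang_nonempty h hw)
  · rintro (rfl | h)
    · exact ⟨x, .refl x⟩
    · exact exists_reaches_of_gderiv_nonempty h

theorem MinStates_eq_image : MinStates δ x = glang δ '' grState δ x := by
  ext L
  constructor
  · rintro ⟨w, ⟨y, h⟩, rfl⟩
    exact ⟨y, ⟨w, h⟩, h.glang_eq⟩
  · rintro ⟨y, ⟨w, h⟩, rfl⟩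
    exact ⟨w, ⟨y, h⟩, h.glang_eq⟩

theorem GNormal.MinStates_congr {δY : Y → At → Bool ⊕ (Act × Y)} {y : Y} (hN : GNormal δ)
    (hNY : GNormal δY) (hL : glang δ x = glang δY y) : MinStates δ x = MinStates δY y := by
  ext L
  simp only [MinStates, Set.mem_ofPred_eq, hN.mem_gRWords_iff, hNY.mem_gRWords_iff, hL]

theorem minDelta_glang_of_inl {b : Bool} (h : δ x α = Sum.inl b) :
    minDelta (glang δ x) α = Sum.inl b := by
  have hp : ¬ ∃ p : Act, (gderiv [(α, p)] (glang δ x)).Nonempty := by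
    rintro ⟨p, ⟨u, β⟩, y, hy, -⟩
    simp [h] at hy
  have hα : ([], α) ∈ glang δ x ↔ b = true := by simp [glang, GAccepts, h]
  cases b <;> simp [minDelta, hp, hα]

theorem GNormal.minDelta_glang_of_inr (hN : GNormal δ) (h : δ x α = Sum.inr (p, y)) :
    minDelta (glang δ x) α = Sum.inr (p, glang δ y) := by
  have hy : glang δ y = gderiv [(α, p)] (glang δ x) := (GReaches.single h).glang_eq
  have hp : ∃ p : Act, (gderiv [(α, p)] (glang δ x)).Nonempty :=
    ⟨p, hy ▸ hN _ _ _ _ h⟩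
  have hc : hp.choose = p := by
    obtain ⟨⟨u, β⟩, z, hz, -⟩ := hp.choose_spec
    rw [h] at hz
    simp only [Sum.inr.injEq, Prod.mk.injEq] at hz
    exact hz.1.symm
  rw [minDelta, dif_pos hp, hc, hy]

end Reachability

/-- size-minimality of the minimization among language-equivalent finite
normal `G`-automata, with equality exactly in the isomorphic case. -/
theorem min_size_minimal {At Act : Type*} [Fintype At] [Nonempty At] [Fintype Act] [Nonempty Act] {X Y : Type*} [Fintype X] [Fintype Y]
    (δX : X → At → Bool ⊕ (Act × X)) (x : X) (δY : Y → At → Bool ⊕ (Act × Y)) (y : Y)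
    (hNX : GNormal δX) (hNY : GNormal δY) (hL : glang δX x = glang δY y) :
    (MinStates δX x).ncard ≤ Fintype.card Y ∧
    ((MinStates δX x).ncard = Fintype.card Y ↔
      ∃ f : Set (GS At Act) → Y,
        Set.BijOn f (MinStates δX x) Set.univ ∧
        f (glang δX x) = y ∧
        ∀ L ∈ MinStates δX x, ∀ α : At,
          (∀ b : Bool, minDelta L α = Sum.inl b → δY (f L) α = Sum.inl b) ∧
          (∀ (p : Act) (L' : Set (GS At Act)), minDelta L α = Sum.inr (p, L') →
              δY (f L) α = Sum.inr (p, f L'))) := by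
  have hM : MinStates δX x = glang δY '' grState δY y :=
    (hNX.MinStates_congr hNY hL).trans MinStates_eq_image
  have hle : (glang δY '' grState δY y).ncard ≤ (grState δY y).ncard :=
    Set.ncard_image_le (Set.toFinite _)
  have hle' : (grState δY y).ncard ≤ Fintype.card Y := by
    rw [← Nat.card_eq_fintype_card, ← Set.ncard_univ]
    exact Set.ncard_le_ncard (Set.subset_univ _)
  rw [hM, hL]
  refine ⟨hle.trans hle', fun h => ?_, ?_⟩
  · have hreach : grState δY y = Set.univ := by
      refine Set.eq_of_subset_of_ncard_le (Set.subset_univ _) ?_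
      rw [Set.ncard_univ, Nat.card_eq_fintype_card, ← h]
      exact hle
    rw [hreach, Set.image_univ] at h ⊢
    have hinj : Function.Injective (glang δY) := by
      rw [← Set.injOn_univ]
      refine Set.injOn_of_ncard_image_eq ?_
      rw [Set.image_univ, h, Set.ncard_univ, Nat.card_eq_fintype_card]
    have : Nonempty Y := ⟨y⟩
    have hinv : Function.LeftInverse (Function.invFun (glang δY)) (glang δY) :=
      Function.leftInverse_invFun hinj
    refine ⟨Function.invFun (glang δY), ⟨fun _ _ => Set.mem_univ _, ?_, ?_⟩, hinv y, ?_⟩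
    · rintro _ ⟨a, rfl⟩ _ ⟨b, rfl⟩ hab
      rw [hinv, hinv] at hab
      rw [hab]
    · exact fun z _ => ⟨glang δY z, ⟨z, rfl⟩, hinv z⟩
    · rintro _ ⟨z, rfl⟩ α
      rw [hinv]
      rcases hz : δY z α with b | ⟨p, z'⟩
      · simp [minDelta_glang_of_inl hz]
      · rw [hNY.minDelta_glang_of_inr hz]
        refine ⟨fun b hb => by simp at hb, fun q L' hq => ?_⟩
        simp only [Sum.inr.injEq, Prod.mk.injEq] at hq
        rw [← hq.1, ← hq.2, hinv]
  · rintro ⟨f, hf, -⟩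
    rw [← hf.injOn.ncard_image, hf.image_eq, Set.ncard_univ, Nat.card_eq_fintype_card]
end

section
/- Let 𝒳 be a finite normal G-automaton with initial state x, and let T = (S, E, row) be a deterministic observation table whose entries agree with ⟦𝒳⟧, i.e. row(t)(e) = 1 iff te ∈ ⟦𝒳⟧ for all t ∈ S ∪ S·(At·Σ) and e ∈ E. Then the map π : {row(s) | s ∈ S} → {w⁻¹⟦𝒳⟧ | w ∈ R(x)} sending row(s) to s⁻¹⟦𝒳⟧ is a well-defined injective function (in particular every s ∈ S lies in R(x)). -/
open scoped Classical

variable {At Act X Y : Type*}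

/-- If `x →^v y` and `y` accepts a guarded string extending `s`, then `v ++ s` can be read
from `x`. -/
theorem GReaches.append_mem_gRWords_of_accepts {δ : X → At → Bool ⊕ (Act × X)} {x : X}
    {β : At} {u : List (At × Act)} :
    ∀ (s : List (At × Act)) {v : List (At × Act)} {y : X},
      GReaches δ x v y → GAccepts δ y (s ++ u) β → v ++ s ∈ gRWords δ x
  | [], v, y, hv, _ => ⟨y, by simpa using hv⟩
  | (α, p) :: s, v, y, hv, h => by
    obtain ⟨z, hz, hacc⟩ := h
    simpa using GReaches.append_mem_gRWords_of_accepts s (hv.snoc hz) hacc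

/-- for a deterministic observation table whose entries agree with the
language of a finite normal `G`-automaton, the map `row(s) ↦ s⁻¹⟦𝒳⟧` is a well-defined
injective function into the states of `m(𝒳)`; in particular every `s ∈ S` lies in
`R(x)`. -/
theorem table_injection {At Act : Type*} [Fintype At] [Nonempty At] [Fintype Act] [Nonempty Act] {X : Type*} [Fintype X]
    (δ : X → At → Bool ⊕ (Act × X)) (x : X) (hN : GNormal δ)
    (T : ObsTable At Act) (hdet : T.Det)
    (hrow : ∀ t : List (At × Act),
      (t ∈ T.S ∨ ∃ s ∈ T.S, ∃ (α : At) (p : Act), t = s ++ [(α, p)]) →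
      ∀ e ∈ T.E, (e ∈ T.row t ↔ ((t ++ e.1, e.2) : GS At Act) ∈ glang δ x)) :
    (∀ s ∈ T.S, s ∈ gRWords δ x) ∧
    (∀ s ∈ T.S, ∀ t ∈ T.S, T.row s = T.row t →
        gderiv s (glang δ x) = gderiv t (glang δ x)) ∧
    (∀ s ∈ T.S, ∀ t ∈ T.S, gderiv s (glang δ x) = gderiv t (glang δ x) →
        T.row s = T.row t) := by
  refine ⟨fun s hs => ?_, fun s hs t ht h => ?_, fun s hs t ht h => ?_⟩
  · rcases eq_or_ne s [] with rfl | hne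
    · exact ⟨x, .refl x⟩
    · obtain ⟨e, he⟩ := T.row_nonempty s hs hne
      exact (GReaches.refl x).append_mem_gRWords_of_accepts s
        ((hrow s (.inl hs) e (T.row_sub s he)).1 he)
  · rw [T.rows_distinct s hs t ht h]
  · ext e
    by_cases he : e ∈ T.E
    · rw [hrow s (.inl hs) e he, hrow t (.inl ht) e he]
      exact Set.ext_iff.1 h e
    · exact iff_of_false (fun h' => he (T.row_sub s h')) (fun h' => he (T.row_sub t h'))
end

section
/- Let 𝒳 be a finite normal G-automaton and T = (S, E, row) a closed deterministic observation table with row(t)(e) = 1 iff te ∈ ⟦𝒳⟧. Suppose z ∈ GS lies in the symmetric difference of ⟦m(T)⟧ and ⟦𝒳⟧, and let T' = (S, E ∪ suf(z), row') be the extended table with row'(t)(e) = 1 iff te ∈ ⟦𝒳⟧. If T' is closed, then row'(ε)(e) = 0 for all e ∈ E, yet row'(ε)(z') = 1 for some z' ∈ suf(z). -/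
open scoped Classical

variable {At Act X Y : Type*}

theorem GAccepts.append_cons_action_eq {δ : X → At → Bool ⊕ (Act × X)} {α : At} {p q : Act}
    {v w : List (At × Act)} {β γ : At} : ∀ {x : X} {u : List (At × Act)},
    GAccepts δ x (u ++ (α, p) :: v) β → GAccepts δ x (u ++ (α, q) :: w) γ → p = q
  | _, [], ⟨_, h₁, _⟩, ⟨_, h₂, _⟩ => by
    rw [h₁] at h₂
    simp_all
  | _, (_, _) :: u, ⟨y, h₁, k₁⟩, ⟨y', h₂, k₂⟩ => by
    rw [h₁] at h₂
    obtain rfl : y = y' := by simp_all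
    exact GAccepts.append_cons_action_eq (u := u) k₁ k₂

theorem GAccepts.not_append_cons {δ : X → At → Bool ⊕ (Act × X)} {α : At} {p : Act}
    {v : List (At × Act)} {β : At} : ∀ {x : X} {u : List (At × Act)},
    GAccepts δ x u α → ¬ GAccepts δ x (u ++ (α, p) :: v) β
  | _, [], h₁, ⟨_, h₂, _⟩ => by
    simp only [GAccepts] at h₁
    simp_all
  | _, (_, _) :: u, ⟨y, h₁, k₁⟩, ⟨y', h₂, k₂⟩ => by
    rw [h₁] at h₂
    obtain rfl : y = y' := by simp_all
    exact GAccepts.not_append_cons (u := u) k₁ k₂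

/-- The hypothesis transitions, with the representative of the row eliminated. -/
theorem hypDelta_row (T : ObsTable At Act) {s : List (At × Act)} (hs : s ∈ T.S) (α : At) :
    hypDelta T (T.row s) α =
      if hp : ∃ p : Act, (T.row (s ++ [(α, p)])).Nonempty then
        Sum.inr (hp.choose, T.row (s ++ [(α, hp.choose)]))
      else if (([], α) : GS At Act) ∈ T.row s then Sum.inl true
      else Sum.inl false := by
  have h : ∃ t, t ∈ T.S ∧ T.row t = T.row s := ⟨s, hs, rfl⟩
  have hc : h.choose = s :=
    T.rows_distinct _ h.choose_spec.1 _ hs h.choose_spec.2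
  simp only [hypDelta, dif_pos h, hc]

theorem mem_gsufAux_self (w : List (At × Act)) (β : At) :
    ((w, β) : GS At Act) ∈ gsufAux w β := by
  cases w <;> simp [gsufAux]

/-- `row` records membership of `t·e` in `L` for all rows and columns of `T`. -/
def ObsTable.Records (T : ObsTable At Act) (L : Set (GS At Act)) : Prop :=
  ∀ t : List (At × Act),
    (t ∈ T.S ∨ ∃ s ∈ T.S, ∃ (α : At) (p : Act), t = s ++ [(α, p)]) →
    ∀ e ∈ T.E, (e ∈ T.row t ↔ ((t ++ e.1, e.2) : GS At Act) ∈ L)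

/-- A nonzero row of a closed extension `T'` of `T` is represented in `T.S`, simultaneously in
both tables. -/
theorem ObsTable.Closed.exists_common_row {L : Set (GS At Act)} {T T' : ObsTable At Act}
    (hcl' : T'.Closed) (hrow : T.Records L) (hrow' : T'.Records L)
    (hS : T'.S = T.S) (hE : T.E ⊆ T'.E) {s : List (At × Act)} (hs : s ∈ T.S) {α : At} {p : Act}
    (hne : (T'.row (s ++ [(α, p)])).Nonempty) :
    ∃ t ∈ T.S, T'.row t = T'.row (s ++ [(α, p)]) ∧ T.row t = T.row (s ++ [(α, p)]) := by
  obtain ⟨t, ht, hrt⟩ := hcl' s (hS ▸ hs) α p hne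
  have ht' : t ∈ T.S := hS ▸ ht
  refine ⟨t, ht', hrt, Set.ext fun e => ?_⟩
  by_cases he : e ∈ T.E
  · rw [hrow t (Or.inl ht') e he, hrow _ (Or.inr ⟨s, hs, α, p, rfl⟩) e he,
      ← hrow' t (Or.inl ht) e (hE he),
      ← hrow' _ (Or.inr ⟨s, hS ▸ hs, α, p, rfl⟩) e (hE he), hrt]
  · exact iff_of_false (fun h => he (T.row_sub _ h)) (fun h => he (T.row_sub _ h))

/-- If a closed extension `T'` of `T` has no lower row that is zero in `T` but not in `T'`, then
`m(T)` classifies correctly every string all of whose suffixes are columns of `T'`. -/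
theorem gaccepts_hypDelta_row_iff {δ : X → At → Bool ⊕ (Act × X)} {x : X}
    {T T' : ObsTable At Act} (hrow : T.Records (glang δ x)) (hrow' : T'.Records (glang δ x))
    (hcl' : T'.Closed) (hS : T'.S = T.S) (hE : T.E ⊆ T'.E)
    (hlive : ∀ s ∈ T.S, ∀ (α : At) (p : Act), (T'.row (s ++ [(α, p)])).Nonempty →
      (T.row (s ++ [(α, p)])).Nonempty)
    {β : At} : ∀ {w : List (At × Act)}, gsufAux w β ⊆ T'.E → ∀ {s : List (At × Act)}, s ∈ T.S →
      (GAccepts (hypDelta T) (T.row s) w β ↔ GAccepts δ x (s ++ w) β)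
  | [], _, s, hs => by
    have hβ : (([], β) : GS At Act) ∈ T.row s ↔ GAccepts δ x (s ++ []) β :=
      hrow s (Or.inl hs) ([], β) (T.atoms_mem β)
    rw [← hβ, GAccepts, hypDelta_row T hs]
    split_ifs with hp hm
    · obtain ⟨q, e, he⟩ := hp
      have he' := (hrow _ (Or.inr ⟨s, hs, β, q, rfl⟩) e (T.row_sub _ he)).1 he
      have he'' : GAccepts δ x (s ++ (β, q) :: e.1) e.2 := by simpa [glang] using he'
      refine iff_of_false (by simp) fun h => ?_
      rw [hβ, List.append_nil] at h
      exact h.not_append_cons he''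
    · simp [hm]
    · simp [hm]
  | (α, p) :: w, hw, s, hs => by
    have hw' : gsufAux w β ⊆ T'.E := (Set.subset_insert _ _).trans hw
    have hwE : ((w, β) : GS At Act) ∈ T'.E := hw' (mem_gsufAux_self w β)
    have hlower : ((w, β) : GS At Act) ∈ T'.row (s ++ [(α, p)]) ↔
        GAccepts δ x (s ++ (α, p) :: w) β := by
      simpa [glang] using hrow' _ (Or.inr ⟨s, hS ▸ hs, α, p, rfl⟩) (w, β) hwE
    have hstep : (T'.row (s ++ [(α, p)])).Nonempty →
        (GAccepts (hypDelta T) (T.row (s ++ [(α, p)])) w β ↔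
          GAccepts δ x (s ++ (α, p) :: w) β) := by
      intro hne
      obtain ⟨t, ht, hrt', hrt⟩ := hcl'.exists_common_row hrow hrow' hS hE hs hne
      rw [← hrt, gaccepts_hypDelta_row_iff hrow hrow' hcl' hS hE hlive hw' ht, ← hlower, ← hrt']
      exact (hrow' t (Or.inl (hS ▸ ht)) (w, β) hwE).symm
    have hmono : (T.row (s ++ [(α, p)])).Nonempty → (T'.row (s ++ [(α, p)])).Nonempty := by
      rintro ⟨e, he⟩
      have heE := T.row_sub _ he
      exact ⟨e, (hrow' _ (Or.inr ⟨s, hS ▸ hs, α, p, rfl⟩) e (hE heE)).2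
        ((hrow _ (Or.inr ⟨s, hs, α, p, rfl⟩) e heE).1 he)⟩
    rw [GAccepts, hypDelta_row T hs]
    constructor
    · rintro ⟨L, hL, hacc⟩
      split_ifs at hL with hp hm
      have hspec := hp.choose_spec
      simp only [Sum.inr.injEq, Prod.mk.injEq] at hL
      obtain ⟨hpe, rfl⟩ := hL
      rw [hpe] at hspec hacc
      exact (hstep (hmono hspec)).1 hacc
    · intro hacc
      have hne' : (T'.row (s ++ [(α, p)])).Nonempty := ⟨_, hlower.2 hacc⟩
      have hp : ∃ p : Act, (T.row (s ++ [(α, p)])).Nonempty := ⟨p, hlive s hs α p hne'⟩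
      have hpe : hp.choose = p := by
        obtain ⟨e, he⟩ := hp.choose_spec
        have he' := (hrow _ (Or.inr ⟨s, hs, α, _, rfl⟩) e (T.row_sub _ he)).1 he
        have he'' : GAccepts δ x (s ++ (α, hp.choose) :: e.1) e.2 := by simpa [glang] using he'
        exact he''.append_cons_action_eq hacc
      refine ⟨T.row (s ++ [(α, p)]), ?_, (hstep hne').2 hacc⟩
      rw [dif_pos hp, hpe]

/-- if a counterexample `z` lies in the symmetric difference of `⟦m(T)⟧` and
`⟦𝒳⟧`, and the table `T'` extended by the suffixes of `z` is closed, then the row of `ε`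
in `T'` is zero on all of `E` but `1` on some suffix of `z`. -/
theorem counterexample_closed {At Act : Type*} [Fintype At] [Nonempty At] [Fintype Act] [Nonempty Act] {X : Type*} [Fintype X]
    (δ : X → At → Bool ⊕ (Act × X)) (x : X) (hN : GNormal δ)
    (T : ObsTable At Act) (hdet : T.Det) (hcl : T.Closed)
    (hrow : ∀ t : List (At × Act),
      (t ∈ T.S ∨ ∃ s ∈ T.S, ∃ (α : At) (p : Act), t = s ++ [(α, p)]) →
      ∀ e ∈ T.E, (e ∈ T.row t ↔ ((t ++ e.1, e.2) : GS At Act) ∈ glang δ x))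
    (z : GS At Act)
    (hz : ¬ (z ∈ glang (hypDelta T) (T.row []) ↔ z ∈ glang δ x))
    (T' : ObsTable At Act) (hS : T'.S = T.S) (hE : T'.E = T.E ∪ gsuf z)
    (hrow' : ∀ t : List (At × Act),
      (t ∈ T'.S ∨ ∃ s ∈ T'.S, ∃ (α : At) (p : Act), t = s ++ [(α, p)]) →
      ∀ e ∈ T'.E, (e ∈ T'.row t ↔ ((t ++ e.1, e.2) : GS At Act) ∈ glang δ x))
    (hcl' : T'.Closed) :
    (∀ e ∈ T.E, e ∉ T'.row []) ∧ ∃ z' ∈ gsuf z, z' ∈ T'.row [] := by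
  have hE' : T.E ⊆ T'.E := hE ▸ Set.subset_union_left
  by_cases hlive : ∀ s ∈ T.S, ∀ (α : At) (p : Act), (T'.row (s ++ [(α, p)])).Nonempty →
      (T.row (s ++ [(α, p)])).Nonempty
  · have hzE : gsufAux z.1 z.2 ⊆ T'.E := hE ▸ Set.subset_union_right
    exact absurd
      (gaccepts_hypDelta_row_iff hrow hrow' hcl' hS hE' hlive hzE T.eps_mem) hz
  · push Not at hlive
    obtain ⟨s, hs, α, p, hne, hempty⟩ := hlive
    obtain ⟨t, ht, hrt', hrt⟩ :=
      ObsTable.Closed.exists_common_row (L := glang δ x) hcl' hrow hrow' hS hE' hs hne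
    rw [hempty] at hrt
    obtain rfl : t = [] := by
      by_contra h
      exact (T.row_nonempty t ht h).ne_empty hrt
    have hzero : ∀ e ∈ T.E, e ∉ T'.row [] := by
      intro e he h
      rw [hrow' [] (Or.inl T'.eps_mem) e (hE' he), ← hrow [] (Or.inl ht) e he, hrt] at h
      exact h
    obtain ⟨e, he⟩ := hne
    rw [← hrt'] at he
    have heE := T'.row_sub _ he
    rw [hE] at heE
    exact ⟨hzero, e, heE.resolve_left fun h => hzero e h he, he⟩
end

section
/- For states x and y of G-coalgebras, x and y are bisimilar (x ≃ y) if and only if x is similar to y (x ≲ y) and y is similar to x (y ≲ x). -/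
open scoped Classical

variable {At Act X Y : Type*}

theorem IsGBisim.isGSim {δX : X → At → Bool ⊕ (Act × X)} {δY : Y → At → Bool ⊕ (Act × Y)}
    {R : X → Y → Prop} (hR : IsGBisim δX δY R) : IsGSim δX δY R :=
  fun x y hxy α => ⟨(hR x y hxy α).1 true, (hR x y hxy α).2⟩

/-- The converse of a bisimulation is a bisimulation. -/
theorem IsGBisim.flip {δX : X → At → Bool ⊕ (Act × X)} {δY : Y → At → Bool ⊕ (Act × Y)}
    {R : X → Y → Prop} (hR : IsGBisim δX δY R) : IsGBisim δY δX (flip R) := by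
  intro y x hxy α
  obtain ⟨hout, hstep⟩ := hR x y hxy α
  rcases hx : δX x α with b | ⟨p, x'⟩
  · simp [hout b hx]
  · obtain ⟨y', hy, hxy'⟩ := hstep p x' hx
    refine ⟨by simp [hy], fun q z hz => ?_⟩
    obtain ⟨rfl, rfl⟩ : p = q ∧ y' = z := by simpa [hy] using hz
    exact ⟨x', rfl, hxy'⟩

/-- The intersection of a simulation with the converse of a simulation in the other direction
is a bisimulation. -/
theorem IsGSim.isGBisim_inter {δX : X → At → Bool ⊕ (Act × X)}
    {δY : Y → At → Bool ⊕ (Act × Y)} {R : X → Y → Prop} {S : Y → X → Prop}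
    (hR : IsGSim δX δY R) (hS : IsGSim δY δX S) :
    IsGBisim δX δY fun x y => R x y ∧ S y x := by
  rintro x y ⟨hxy, hyx⟩ α
  obtain ⟨haccX, hstepX⟩ := hR x y hxy α
  obtain ⟨haccY, hstepY⟩ := hS y x hyx α
  refine ⟨fun b hb => ?_, fun p x' hx => ?_⟩
  · rcases hy : δY y α with c | ⟨q, y'⟩
    · cases b <;> cases c <;> simp_all
    · obtain ⟨x', hx, -⟩ := hstepY q y' hy
      simp [hb] at hx
  · obtain ⟨y', hy, hxy'⟩ := hstepX p x' hx
    obtain ⟨z, hz, hyz⟩ := hstepY p y' hy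
    obtain rfl : x' = z := by simpa [hx] using hz
    exact ⟨y', hy, hxy', hyz⟩

/-- two states are bisimilar iff each is similar to the other. -/
theorem bisimilar_iff_similar {At Act : Type*} [Fintype At] [Nonempty At] [Fintype Act] [Nonempty Act] {X Y : Type*}
    (δX : X → At → Bool ⊕ (Act × X)) (δY : Y → At → Bool ⊕ (Act × Y)) (x : X) (y : Y) :
    GBisimilar δX δY x y ↔ GSimilar δX δY x y ∧ GSimilar δY δX y x := by
  constructor
  · rintro ⟨R, hR, hxy⟩
    exact ⟨⟨R, hR.isGSim, hxy⟩, ⟨flip R, hR.flip.isGSim, hxy⟩⟩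
  · rintro ⟨⟨R, hR, hxy⟩, ⟨S, hS, hyx⟩⟩
    exact ⟨_, hR.isGBisim_inter hS, hxy, hyx⟩
end
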